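/- Let X be a finite poset. Assume there exist a maximal connected subset Y of X (maximal in C(X) under inclusion), elements a, b, c, d ∈ Y and n ≥ 1 satisfying: (i) the subposet Y satisfies condition (*_{n−1}); (ii) |min_Y(a) ∪ min_Y(b)| = n; (iii) min_Y(a) ⊊ min_Y(b); (iv) min_Y(c) = min_Y(d) = min_Y(a) ∪ min_Y(b); (v) a ≤ c, a ≤ d, b ≤ c, b ≤ d; (vi) there is no e ∈ Y with a ≤ e, b ≤ e, e ≤ c and e ≤ d. Then the preordered class Un(X) of unifiers for X admits no minimal complete set (type 0). -/

import Mathlib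

/-- The set of minimal elements of a poset `X` lying below `x`. -/
def minBelow (X : Type*) [PartialOrder X] (x : X) : Set X :=
  {m | m ≤ x ∧ ∀ z : X, z ≤ m → z = m}

/-- A p-morphism between posets: a monotone map commuting with `minBelow`. -/
def IsPMorphism {X Y : Type*} [PartialOrder X] [PartialOrder Y] (u : X → Y) : Prop :=
  Monotone u ∧ ∀ x : X, u '' minBelow X x = minBelow Y (u x)

/-- Condition `(*)`. -/
def StarCond (X : Type*) [PartialOrder X] : Prop :=
  ∀ x y : X, ∃ z : X, IsLUB {x, y} z ∧ minBelow X z = minBelow X x ∪ minBelow X y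

/-- Condition `(*_n)` for `n ≥ 1`. -/
def StarCondN (n : ℕ) (X : Type*) [PartialOrder X] : Prop :=
  ∀ x y : X, (minBelow X x ∪ minBelow X y).ncard ≤ n →
    ∃ z : X, IsLUB {x, y} z ∧ minBelow X z = minBelow X x ∪ minBelow X y

/-- Condition `(*_n)` with the convention that `(*_0)` means nonempty. -/
def StarCondN' (n : ℕ) (X : Type*) [PartialOrder X] : Prop :=
  if n = 0 then Nonempty X else StarCondN n X

/-- The poset `X` belongs to the class `P^f_n`. -/
def InPfn (n : ℕ) (X : Type*) [PartialOrder X] : Prop :=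
  ∀ x : X, (minBelow X x).ncard ≤ n

/-- `M` is a complete set for the preordered class `(S, le)`. -/
def IsCompleteSet {S : Type*} (le : S → S → Prop) (M : Set S) : Prop :=
  ∀ x : S, ∃ y ∈ M, le x y

/-- `M` is a minimal complete set for the preordered class `(S, le)`. -/
def IsMinimalCompleteSet {S : Type*} (le : S → S → Prop) (M : Set S) : Prop :=
  IsCompleteSet le M ∧ ∀ x ∈ M, ∀ y ∈ M, le x y → x = y

/-- A connected subset of a poset. -/
def IsConnectedSub (X : Type*) [PartialOrder X] (Y : Set X) : Prop :=
  (∀ y ∈ Y, minBelow X y ⊆ Y) ∧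
  ∀ x ∈ Y, ∀ y ∈ Y, ∃ z ∈ Y, x ≤ z ∧ y ≤ z ∧
    minBelow X z = minBelow X x ∪ minBelow X y

/-- An `n`-connected subset of a poset. -/
def IsNConnectedSub (n : ℕ) (X : Type*) [PartialOrder X] (Y : Set X) : Prop :=
  (∀ y ∈ Y, minBelow X y ⊆ Y) ∧
  (∀ S : Set X, S ⊆ (⋃ y ∈ Y, minBelow X y) → S.Nonempty → S.ncard ≤ n →
    ∃ z ∈ Y, minBelow X z = S) ∧
  (∀ x ∈ Y, ∀ y ∈ Y, minBelow X x = minBelow X y → (minBelow X x).ncard < n →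
    ∃ (r : ℕ) (c : ℕ → X), c 0 = x ∧ c r = y ∧ (∀ i ≤ r, c i ∈ Y) ∧
      (∀ i ≤ r, minBelow X (c i) = minBelow X x) ∧
      (∀ i < r, if Even i then c (i + 1) ≤ c i else c i ≤ c (i + 1)))

/-- The special product `X ⊙ Y`. -/
abbrev Odot (X Y : Type*) : Type _ :=
  {p : WithBot X × WithBot Y // p ≠ (⊥, ⊥)}

/-- The subposet `(X)_n` of elements with at most `n` minimal elements below them. -/
abbrev SubPn (n : ℕ) (X : Type*) [PartialOrder X] : Type _ :=
  {x : X // (minBelow X x).ncard ≤ n}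

/-- A unifier for a finite poset `X`: a p-morphism into `X` from a nonempty finite
poset satisfying `(*)`. -/
structure Unifier (X : Type) [PartialOrder X] [Finite X] : Type 1 where
  Y : Type
  [po : PartialOrder Y]
  [fin : Finite Y]
  ne : Nonempty Y
  star : StarCond Y
  u : Y → X
  hu : IsPMorphism u

attribute [instance] Unifier.po Unifier.fin

/-- The "more general" preorder on unifiers: `v ≼ w`. -/
def UnifierLE {X : Type} [PartialOrder X] [Finite X] (v w : Unifier X) : Prop :=
  ∃ ψ : v.Y → w.Y, IsPMorphism ψ ∧ w.u ∘ ψ = v.u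

/-- An `n`-unifier for a finite poset `X` in `P^f_n`. -/
structure UnifierN (n : ℕ) (X : Type) [PartialOrder X] [Finite X] : Type 1 where
  Y : Type
  [po : PartialOrder Y]
  [fin : Finite Y]
  ne : Nonempty Y
  mem : InPfn n Y
  star : StarCondN n Y
  u : Y → X
  hu : IsPMorphism u

attribute [instance] UnifierN.po UnifierN.fin

/-- The "more general" preorder on `n`-unifiers: `v ≼ w`. -/
def UnifierNLE {n : ℕ} {X : Type} [PartialOrder X] [Finite X] (v w : UnifierN n X) : Prop :=
  ∃ ψ : v.Y → w.Y, IsPMorphism ψ ∧ w.u ∘ ψ = v.u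

section PMorphism

variable {X Y Z : Type*} [PartialOrder X] [PartialOrder Y] [PartialOrder Z]

theorem minBelow_mono {x y : X} (h : x ≤ y) : minBelow X x ⊆ minBelow X y :=
  fun _ hm => ⟨hm.1.trans h, hm.2⟩

theorem minBelow_of_mem {x m : X} (hm : m ∈ minBelow X x) : minBelow X m = {m} := by
  ext z
  constructor
  · exact fun hz => hm.2 z hz.1
  · rintro rfl
    exact ⟨le_rfl, hm.2⟩

theorem mem_minBelow_self {x m : X} (hm : m ∈ minBelow X x) : m ∈ minBelow X m :=
  ⟨le_rfl, hm.2⟩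

theorem minBelow_nonempty [Finite X] (x : X) : (minBelow X x).Nonempty := by
  induction x using WellFoundedLT.induction with
  | ind x ih =>
    by_cases h : ∀ z, z ≤ x → z = x
    · exact ⟨x, le_rfl, h⟩
    · push Not at h
      obtain ⟨z, hzx, hne⟩ := h
      exact (ih z (lt_of_le_of_ne hzx hne)).mono (minBelow_mono hzx)

theorem IsPMorphism.comp {g : Y → Z} {f : X → Y} (hg : IsPMorphism g) (hf : IsPMorphism f) :
    IsPMorphism (g ∘ f) :=
  ⟨hg.1.comp hf.1, fun x => by rw [Set.image_comp, hf.2, hg.2, Function.comp_apply]⟩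

theorem IsPMorphism.isConnectedSub_range {f : X → Y} (hf : IsPMorphism f) (hX : StarCond X) :
    IsConnectedSub Y (Set.range f) := by
  constructor
  · rintro _ ⟨x, rfl⟩
    rw [← hf.2 x]
    exact Set.image_subset_range _ _
  · rintro _ ⟨x, rfl⟩ _ ⟨y, rfl⟩
    obtain ⟨z, hz, hmin⟩ := hX x y
    refine ⟨f z, ⟨z, rfl⟩, hf.1 (hz.1 (by simp)), hf.1 (hz.1 (by simp)), ?_⟩
    rw [← hf.2, ← hf.2, ← hf.2, hmin, Set.image_union]

end PMorphism

section Connected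

variable {X : Type*} [PartialOrder X] {C : Set X}

theorem IsConnectedSub.exists_upperBound (hC : IsConnectedSub X C) {T : Set X} (hT : T.Finite)
    (hne : T.Nonempty) (hTC : T ⊆ C) :
    ∃ z ∈ C, (∀ t ∈ T, t ≤ z) ∧ minBelow X z = ⋃ t ∈ T, minBelow X t := by
  induction T, hT using Set.Finite.induction_on with
  | empty => exact absurd hne (by simp)
  | @insert t T _ _ ih =>
    have htC : t ∈ C := hTC (Set.mem_insert _ _)
    rcases T.eq_empty_or_nonempty with rfl | hT
    · exact ⟨t, htC, by simp, by simp⟩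
    · obtain ⟨z, hz, hub, hmin⟩ := ih hT ((Set.subset_insert _ _).trans hTC)
      obtain ⟨y, hy, hty, hzy, hminy⟩ := hC.2 t htC z hz
      refine ⟨y, hy, ?_, ?_⟩
      · rintro s (rfl | hs)
        · exact hty
        · exact (hub s hs).trans hzy
      · rw [hminy, hmin, Set.biUnion_insert]

/-- A partial p-morphism into a connected subset, defined on a lower set containing all minimal
elements, extends to a p-morphism. -/
theorem IsConnectedSub.exists_isPMorphism_extension {W : Type*} [PartialOrder W] [Finite W]
    (hC : IsConnectedSub X C) (D : Set W) (hD : IsLowerSet D)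
    (hDmin : ∀ m : W, (∀ z, z ≤ m → z = m) → m ∈ D) (f₀ : W → X)
    (hmaps : ∀ x ∈ D, f₀ x ∈ C) (hmono : MonotoneOn f₀ D)
    (hmin : ∀ x ∈ D, f₀ '' minBelow W x = minBelow X (f₀ x)) :
    ∃ f : W → X, IsPMorphism f ∧ Set.EqOn f f₀ D ∧ Set.range f ⊆ C := by
  classical
  induction hk : Dᶜ.ncard generalizing D f₀ with
  | zero =>
    have hD' : ∀ x, x ∈ D := fun x => by
      have : Dᶜ = ∅ := (Set.ncard_eq_zero (Set.toFinite _)).1 hk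
      simpa using Set.eq_empty_iff_forall_notMem.1 this x
    refine ⟨f₀, ⟨fun x y h => hmono (hD' x) (hD' y) h, fun x => hmin x (hD' x)⟩,
      fun _ _ => rfl, ?_⟩
    rintro _ ⟨x, rfl⟩
    exact hmaps x (hD' x)
  | succ k ih =>
    have hne : Dᶜ.Nonempty := by
      rw [← Set.ncard_pos (Set.toFinite _)]
      omega
    obtain ⟨x, hx, hxmin⟩ := (Set.toFinite Dᶜ).exists_minimal hne
    have hlt : ∀ y, y < x → y ∈ D := fun y hy => by
      by_contra hyD
      exact hy.not_ge (hxmin hyD hy.le)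
    have hex : ∃ y, y < x := by
      by_contra! h
      exact hx (hDmin x fun z hz => by_contra fun hzx => h z (lt_of_le_of_ne hz hzx))
    obtain ⟨z, hzC, hub, hminz⟩ := hC.exists_upperBound (T := f₀ '' Set.Iio x) (Set.toFinite _)
      (Set.Nonempty.image f₀ hex)
      (by rintro _ ⟨y, hy, rfl⟩; exact hmaps y (hlt y hy))
    have hbelow : minBelow W x = ⋃ y ∈ Set.Iio x, minBelow W y := by
      ext m
      simp only [Set.mem_iUnion, exists_prop]
      constructor
      · intro hm
        refine ⟨m, lt_of_le_of_ne hm.1 ?_, mem_minBelow_self hm⟩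
        rintro rfl
        exact hx (hDmin m hm.2)
      · rintro ⟨y, hy, hm⟩
        exact minBelow_mono (le_of_lt hy) hm
    set f₁ := Function.update f₀ x z
    have hfx : f₁ x = z := Function.update_self _ _ _
    have hfD : ∀ y ∈ D, f₁ y = f₀ y := fun y hy =>
      Function.update_of_ne (by rintro rfl; exact hx hy) _ _
    have hminD : ∀ y m, m ∈ minBelow W y → m ∈ D := fun y m hm => hDmin m hm.2
    have himg : ∀ y, f₁ '' minBelow W y = f₀ '' minBelow W y := fun y =>
      Set.image_congr fun m hm => hfD m (hminD y m hm)
    have hcard : (insert x D)ᶜ.ncard = k := by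
      have : (insert x D)ᶜ = Dᶜ \ {x} := by
        ext y
        simp [not_or, and_comm]
      rw [this, Set.ncard_sdiff_singleton_of_mem hx, hk, Nat.add_sub_cancel]
    obtain ⟨f, hf, hfe, hfr⟩ := ih (insert x D)
      (by
        rintro y y' hy' (rfl | hy)
        · rcases hy'.eq_or_lt with rfl | h
          · exact Set.mem_insert _ _
          · exact Set.mem_insert_of_mem _ (hlt _ h)
        · exact Set.mem_insert_of_mem _ (hD hy' hy))
      (fun m hm => Set.mem_insert_of_mem _ (hDmin m hm)) f₁
      (by
        rintro y (rfl | hy)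
        · rwa [hfx]
        · rw [hfD y hy]
          exact hmaps y hy)
      (by
        rintro y (rfl | hy) y' (rfl | hy') h
        · exact le_rfl
        · exact absurd (hD h hy') hx
        · rw [hfx, hfD y hy]
          exact hub _ ⟨y, lt_of_le_of_ne h (fun e => hx (e ▸ hy)), rfl⟩
        · rw [hfD y hy, hfD y' hy']
          exact hmono hy hy' h)
      (by
        rintro y (rfl | hy)
        · rw [himg, hfx, hminz, hbelow, Set.image_iUnion₂, Set.biUnion_image]
          exact Set.iUnion₂_congr fun y' hy' => hmin y' (hlt y' hy')
        · rw [himg, hfD y hy]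
          exact hmin y hy)
      hcard
    exact ⟨f, hf, fun y hy => (hfe (Set.mem_insert_of_mem _ hy)).trans (hfD y hy), hfr⟩

end Connected

section Odot

variable {X Y : Type*}

/-- The left inclusion into the special product. -/
def Odot.inl (x : X) : Odot X Y := ⟨(x, ⊥), by simp⟩

/-- The right inclusion into the special product. -/
def Odot.inr (y : Y) : Odot X Y := ⟨(⊥, y), by simp⟩

theorem Odot.inl_injective : Function.Injective (Odot.inl : X → Odot X Y) := fun x x' h => by
  simpa [Odot.inl] using h

theorem Odot.inr_injective : Function.Injective (Odot.inr : Y → Odot X Y) := fun x x' h => by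
  simpa [Odot.inr] using h

variable [PartialOrder X] [PartialOrder Y]

theorem StarCond.exists_isLUB_withBot (hX : StarCond X) (x y : WithBot X) :
    ∃ z : WithBot X, IsLUB {x, y} z ∧ (z = ⊥ → x = ⊥ ∧ y = ⊥) ∧
      ∀ m : X, (∀ t, t ≤ m → t = m) →
        ((m : WithBot X) ≤ z ↔ (m : WithBot X) ≤ x ∨ (m : WithBot X) ≤ y) := by
  have hbot : ∀ z : WithBot X, IsLUB {⊥, z} z := fun z =>
    ⟨by rintro _ (rfl | rfl); exacts [bot_le, le_rfl], fun t ht => ht (by simp)⟩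
  induction x with
  | bot => exact ⟨y, hbot y, fun h => ⟨rfl, h⟩, by simp⟩
  | coe x =>
    induction y with
    | bot => exact ⟨x, Set.pair_comm _ _ ▸ hbot x, by simp, by simp⟩
    | coe y =>
      obtain ⟨z, hz, hmin⟩ := hX x y
      refine ⟨z, ⟨?_, ?_⟩, by simp, ?_⟩
      · rintro _ (rfl | rfl)
        · exact WithBot.coe_le_coe.2 (hz.1 (by simp))
        · exact WithBot.coe_le_coe.2 (hz.1 (by simp))
      · intro t ht
        have h1 : (x : WithBot X) ≤ t := ht (by simp)
        have h2 : (y : WithBot X) ≤ t := ht (by simp)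
        induction t with
        | bot => simp at h1
        | coe t =>
          rw [WithBot.coe_le_coe] at h1 h2 ⊢
          exact hz.2 (by rintro _ (rfl | rfl) <;> assumption)
      · intro m hm
        simp only [WithBot.coe_le_coe]
        have := Set.ext_iff.1 hmin m
        simpa only [minBelow, Set.mem_union, Set.mem_ofPred_eq, and_iff_left hm] using this

theorem Odot.exists_le (p : Odot X Y) :
    (∃ x : X, Odot.inl x ≤ p) ∨ ∃ y : Y, Odot.inr y ≤ p := by
  obtain ⟨⟨x, y⟩, h⟩ := p
  induction x with
  | bot =>
    induction y with
    | bot => simp at h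
    | coe y => exact Or.inr ⟨y, ⟨bot_le, le_rfl⟩⟩
  | coe x => exact Or.inl ⟨x, ⟨le_rfl, bot_le⟩⟩

theorem Odot.le_inl_iff {p : Odot X Y} {x : X} :
    p ≤ Odot.inl x ↔ ∃ x' ≤ x, p = Odot.inl x' := by
  constructor
  · obtain ⟨⟨x', y⟩, h⟩ := p
    rintro ⟨h1, h2⟩
    obtain rfl : y = ⊥ := le_bot_iff.1 h2
    induction x' with
    | bot => simp at h
    | coe x' => exact ⟨x', WithBot.coe_le_coe.1 h1, rfl⟩
  · rintro ⟨x', h, rfl⟩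
    exact ⟨WithBot.coe_le_coe.2 h, le_rfl⟩

theorem Odot.le_inr_iff {p : Odot X Y} {y : Y} :
    p ≤ Odot.inr y ↔ ∃ y' ≤ y, p = Odot.inr y' := by
  constructor
  · obtain ⟨⟨x, y'⟩, h⟩ := p
    rintro ⟨h1, h2⟩
    obtain rfl : x = ⊥ := le_bot_iff.1 h1
    induction y' with
    | bot => simp at h
    | coe y' => exact ⟨y', WithBot.coe_le_coe.1 h2, rfl⟩
  · rintro ⟨y', h, rfl⟩
    exact ⟨le_rfl, WithBot.coe_le_coe.2 h⟩

theorem Odot.inl_isMin_iff {x : X} :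
    (∀ z : Odot X Y, z ≤ Odot.inl x → z = Odot.inl x) ↔ ∀ z, z ≤ x → z = x := by
  constructor
  · exact fun h z hz => Odot.inl_injective (h _ (Odot.le_inl_iff.2 ⟨z, hz, rfl⟩))
  · intro h z hz
    obtain ⟨x', hx', rfl⟩ := Odot.le_inl_iff.1 hz
    rw [h x' hx']

theorem Odot.inr_isMin_iff {y : Y} :
    (∀ z : Odot X Y, z ≤ Odot.inr y → z = Odot.inr y) ↔ ∀ z, z ≤ y → z = y := by
  constructor
  · exact fun h z hz => Odot.inr_injective (h _ (Odot.le_inr_iff.2 ⟨z, hz, rfl⟩))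
  · intro h z hz
    obtain ⟨x', hx', rfl⟩ := Odot.le_inr_iff.1 hz
    rw [h x' hx']

theorem Odot.minBelow_inl (x : X) :
    minBelow (Odot X Y) (Odot.inl x) = Odot.inl '' minBelow X x := by
  ext p
  constructor
  · rintro ⟨h, hp⟩
    obtain ⟨x', hx', rfl⟩ := Odot.le_inl_iff.1 h
    exact ⟨x', ⟨hx', Odot.inl_isMin_iff.1 hp⟩, rfl⟩
  · rintro ⟨x', ⟨hx', hm⟩, rfl⟩
    exact ⟨Odot.le_inl_iff.2 ⟨x', hx', rfl⟩, Odot.inl_isMin_iff.2 hm⟩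

theorem Odot.minBelow_inr (y : Y) :
    minBelow (Odot X Y) (Odot.inr y) = Odot.inr '' minBelow Y y := by
  ext p
  constructor
  · rintro ⟨h, hp⟩
    obtain ⟨y', hy', rfl⟩ := Odot.le_inr_iff.1 h
    exact ⟨y', ⟨hy', Odot.inr_isMin_iff.1 hp⟩, rfl⟩
  · rintro ⟨y', ⟨hy', hm⟩, rfl⟩
    exact ⟨Odot.le_inr_iff.2 ⟨y', hy', rfl⟩, Odot.inr_isMin_iff.2 hm⟩

theorem Odot.isPMorphism_inl : IsPMorphism (Odot.inl : X → Odot X Y) :=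
  ⟨fun x _ h => Odot.le_inl_iff.2 ⟨x, h, rfl⟩, fun x => (Odot.minBelow_inl x).symm⟩

theorem Odot.isPMorphism_inr : IsPMorphism (Odot.inr : Y → Odot X Y) :=
  ⟨fun y _ h => Odot.le_inr_iff.2 ⟨y, h, rfl⟩, fun y => (Odot.minBelow_inr y).symm⟩

theorem Odot.eq_inl_or_eq_inr_of_isMin {p : Odot X Y} (hp : ∀ z, z ≤ p → z = p) :
    (∃ x, p = Odot.inl x) ∨ ∃ y, p = Odot.inr y :=
  (Odot.exists_le p).imp (fun ⟨x, hx⟩ => ⟨x, (hp _ hx).symm⟩) fun ⟨y, hy⟩ => ⟨y, (hp _ hy).symm⟩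

theorem StarCond.odot (hX : StarCond X) (hY : StarCond Y) : StarCond (Odot X Y) := by
  rintro ⟨⟨x, y⟩, hp⟩ ⟨⟨x', y'⟩, hp'⟩
  obtain ⟨s, hs, hs0, hsm⟩ := hX.exists_isLUB_withBot x x'
  obtain ⟨t, ht, ht0, htm⟩ := hY.exists_isLUB_withBot y y'
  refine ⟨⟨(s, t), fun h => ?_⟩, ⟨?_, ?_⟩, ?_⟩
  · obtain ⟨h1, h2⟩ := Prod.mk.inj h
    exact hp (by rw [(hs0 h1).1, (ht0 h2).1])
  · rintro _ (rfl | rfl)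
    · exact ⟨hs.1 (by simp), ht.1 (by simp)⟩
    · exact ⟨hs.1 (by simp), ht.1 (by simp)⟩
  · rintro ⟨⟨u, v⟩, hq⟩ hub
    have h1 := hub (Set.mem_insert _ _)
    have h2 := hub (Set.mem_insert_of_mem _ rfl)
    exact ⟨hs.2 (by rintro _ (rfl | rfl); exacts [h1.1, h2.1]),
      ht.2 (by rintro _ (rfl | rfl); exacts [h1.2, h2.2])⟩
  · ext q
    simp only [minBelow, Set.mem_union, Set.mem_ofPred_eq, ← or_and_right]
    refine and_congr_left fun hq => ?_
    rcases Odot.eq_inl_or_eq_inr_of_isMin hq with ⟨m, rfl⟩ | ⟨m, rfl⟩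
    · have := hsm m (Odot.inl_isMin_iff.1 hq)
      simpa [Odot.inl, ← Subtype.coe_le_coe, Prod.le_def] using this
    · have := htm m (Odot.inr_isMin_iff.1 hq)
      simpa [Odot.inr, ← Subtype.coe_le_coe, Prod.le_def] using this

end Odot

section Unifier

variable {X : Type} [PartialOrder X] [Finite X]

theorem UnifierLE.trans {u v w : Unifier X} (h : UnifierLE u v) (h' : UnifierLE v w) :
    UnifierLE u w := by
  obtain ⟨f, hf, hfu⟩ := h
  obtain ⟨g, hg, hgu⟩ := h'
  exact ⟨g ∘ f, hg.comp hf, by rw [← Function.comp_assoc, hgu, hfu]⟩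

/-- Two unifiers, the range of one containing the range of the other, have an upper bound. -/
theorem Unifier.exists_upperBound (v w : Unifier X) (h : Set.range v.u ⊆ Set.range w.u) :
    ∃ t : Unifier X, UnifierLE v t ∧ UnifierLE w t := by
  classical
  let D : Set (Odot v.Y w.Y) := Set.range Odot.inl ∪ Set.range Odot.inr
  let f₀ : Odot v.Y w.Y → X := fun p =>
    if h : ∃ x, p = Odot.inl x then v.u h.choose
    else if h : ∃ y, p = Odot.inr y then w.u h.choose else w.u w.ne.some
  have hl : ∀ x, f₀ (Odot.inl x) = v.u x := fun x => by
    have hx : ∃ x', (Odot.inl x : Odot v.Y w.Y) = Odot.inl x' := ⟨x, rfl⟩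
    simp only [f₀, dif_pos hx]
    rw [← Odot.inl_injective hx.choose_spec]
  have hr : ∀ y, f₀ (Odot.inr y) = w.u y := fun y => by
    have hx : ¬ ∃ x', (Odot.inr y : Odot v.Y w.Y) = Odot.inl x' := by
      simp [Odot.inl, Odot.inr]
    have hy : ∃ y', (Odot.inr y : Odot v.Y w.Y) = Odot.inr y' := ⟨y, rfl⟩
    simp only [f₀, dif_neg hx, dif_pos hy]
    rw [← Odot.inr_injective hy.choose_spec]
  have hne : ∀ x y, ¬ (Odot.inl x : Odot v.Y w.Y) ≤ Odot.inr y := fun x y hle => by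
    simpa [Odot.inl, Odot.inr] using hle.1
  have hne' : ∀ x y, ¬ (Odot.inr y : Odot v.Y w.Y) ≤ Odot.inl x := fun x y hle => by
    simpa [Odot.inl, Odot.inr] using hle.2
  obtain ⟨f, hf, hfD, -⟩ :=
    (w.hu.isConnectedSub_range w.star).exists_isPMorphism_extension D
      (by
        rintro p q hqp (⟨x, rfl⟩ | ⟨y, rfl⟩)
        · obtain ⟨x', -, rfl⟩ := Odot.le_inl_iff.1 hqp
          exact Or.inl ⟨x', rfl⟩
        · obtain ⟨y', -, rfl⟩ := Odot.le_inr_iff.1 hqp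
          exact Or.inr ⟨y', rfl⟩)
      (fun m hm => (Odot.eq_inl_or_eq_inr_of_isMin hm).imp
        (fun ⟨x, hx⟩ => ⟨x, hx.symm⟩) (fun ⟨y, hy⟩ => ⟨y, hy.symm⟩)) f₀
      (by
        rintro _ (⟨x, rfl⟩ | ⟨y, rfl⟩)
        · rw [hl]
          exact h ⟨x, rfl⟩
        · rw [hr]
          exact ⟨y, rfl⟩)
      (by
        rintro _ (⟨x, rfl⟩ | ⟨y, rfl⟩) _ (⟨x', rfl⟩ | ⟨y', rfl⟩) hle
        · rw [hl, hl]
          exact v.hu.1 (WithBot.coe_le_coe.1 hle.1)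
        · exact absurd hle (hne _ _)
        · exact absurd hle (hne' _ _)
        · rw [hr, hr]
          exact w.hu.1 (WithBot.coe_le_coe.1 hle.2))
      (by
        rintro _ (⟨x, rfl⟩ | ⟨y, rfl⟩)
        · rw [hl, Odot.minBelow_inl, Set.image_image, ← v.hu.2]
          simp only [hl]
        · rw [hr, Odot.minBelow_inr, Set.image_image, ← w.hu.2]
          simp only [hr])
  refine ⟨⟨Odot v.Y w.Y, ⟨Odot.inr w.ne.some⟩, v.star.odot w.star, f, hf⟩,
    ⟨Odot.inl, Odot.isPMorphism_inl, ?_⟩, ⟨Odot.inr, Odot.isPMorphism_inr, ?_⟩⟩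
  · funext x
    exact (hfD (Or.inl ⟨x, rfl⟩)).trans (hl x)
  · funext y
    exact (hfD (Or.inr ⟨y, rfl⟩)).trans (hr y)

/-- If there are unifiers whose upper bounds need arbitrarily large domains, then the unification
type is `0`. -/
theorem not_exists_isMinimalCompleteSet_of_forall_card
    (h : ∀ N : ℕ, ∃ v : Unifier X, ∀ w, UnifierLE v w → N ≤ Nat.card w.Y) :
    ¬ ∃ M : Set (Unifier X), IsMinimalCompleteSet UnifierLE M := by
  rintro ⟨M, hcomplete, hmin⟩
  choose v hv using h
  obtain ⟨R, hR⟩ := Finite.exists_infinite_fiber fun N => Set.range (v N).u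
  rw [Set.infinite_coe_iff] at hR
  obtain ⟨N₀, hN₀⟩ := hR.nonempty
  obtain ⟨w, hwM, hw⟩ := hcomplete (v N₀)
  obtain ⟨N, hN, hlt⟩ := hR.exists_gt (Nat.card w.Y)
  have hsub : Set.range (v N).u ⊆ Set.range w.u := by
    obtain ⟨ψ, -, hψ⟩ := hw
    have h1 : Set.range (v N).u = R := hN
    have h2 : Set.range (v N₀).u = R := hN₀
    rw [h1, ← h2, ← hψ]
    exact Set.range_comp_subset_range _ _
  obtain ⟨t, hvt, hwt⟩ := (v N).exists_upperBound w hsub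
  obtain ⟨w', hw'M, htw'⟩ := hcomplete t
  obtain rfl := hmin w hwM w' hw'M (hwt.trans htw')
  exact absurd (hv N w (hvt.trans htw')) (by omega)

end Unifier

section MarkedSets

variable {K I : Type*} {S : I → Set K}

/-- Nonempty subsets of `K` together with a set of marks, where the mark `i` is only allowed on sets
containing `S i`. -/
abbrev MarkedSets (S : I → Set K) : Type _ :=
  {p : Set K × Set I // p.1.Nonempty ∧ ∀ i ∈ p.2, S i ⊆ p.1}

/-- The unmarked singleton `{k}`. -/
def MarkedSets.single (S : I → Set K) (k : K) : MarkedSets S := ⟨({k}, ∅), by simp⟩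

theorem MarkedSets.single_le_iff {k : K} {p : MarkedSets S} :
    MarkedSets.single S k ≤ p ↔ k ∈ p.1.1 := by
  simp [MarkedSets.single, ← Subtype.coe_le_coe, Prod.le_def]

theorem MarkedSets.eq_single_of_le {k : K} {p : MarkedSets S} (h : p ≤ MarkedSets.single S k) :
    p = MarkedSets.single S k := by
  obtain ⟨⟨s, t⟩, hs, ht⟩ := p
  have h1 : s ⊆ {k} := h.1
  have h2 : t ⊆ ∅ := h.2
  obtain rfl : s = {k} := hs.subset_singleton_iff.1 h1
  obtain rfl : t = ∅ := Set.subset_empty_iff.1 h2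
  rfl

theorem MarkedSets.exists_eq_single {p : MarkedSets S} (h : ∀ z, z ≤ p → z = p) :
    ∃ k ∈ p.1.1, p = MarkedSets.single S k := by
  obtain ⟨k, hk⟩ := p.2.1
  exact ⟨k, hk, (h _ (MarkedSets.single_le_iff.2 hk)).symm⟩

theorem MarkedSets.minBelow_eq (p : MarkedSets S) :
    minBelow (MarkedSets S) p = MarkedSets.single S '' p.1.1 := by
  ext q
  constructor
  · rintro ⟨hqp, hq⟩
    obtain ⟨k, -, rfl⟩ := MarkedSets.exists_eq_single hq
    exact ⟨k, MarkedSets.single_le_iff.1 hqp, rfl⟩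
  · rintro ⟨k, hk, rfl⟩
    exact ⟨MarkedSets.single_le_iff.2 hk, fun z => MarkedSets.eq_single_of_le⟩

theorem MarkedSets.starCond (S : I → Set K) : StarCond (MarkedSets S) := by
  intro p q
  refine ⟨⟨(p.1.1 ∪ q.1.1, p.1.2 ∪ q.1.2), p.2.1.inl, ?_⟩, ⟨?_, ?_⟩, ?_⟩
  · rintro i (hi | hi)
    · exact (p.2.2 i hi).trans Set.subset_union_left
    · exact (q.2.2 i hi).trans Set.subset_union_right
  · rintro _ (rfl | rfl)
    · exact ⟨Set.subset_union_left, Set.subset_union_left⟩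
    · exact ⟨Set.subset_union_right, Set.subset_union_right⟩
  · intro t ht
    have h1 := ht (Set.mem_insert _ _)
    have h2 := ht (Set.mem_insert_of_mem _ rfl)
    exact ⟨Set.union_subset h1.1 h2.1, Set.union_subset h1.2 h2.2⟩
  · simp only [MarkedSets.minBelow_eq, Set.image_union]

end MarkedSets

section HalfGraph

variable {X : Type} [PartialOrder X] [Finite X] {Y : Set X} {a b c d : X}

/-- A unifier whose domain contains copies of `a` and `b`, indexed by `ι`, having common upper bounds
sent to `c` or `d` in the pattern of a half graph. -/
theorem IsConnectedSub.exists_unifier_halfGraph (hY : IsConnectedSub X Y) (ha : a ∈ Y) (hb : b ∈ Y)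
    (hc : c ∈ Y) (hd : d ∈ Y) (hab : minBelow X a ⊂ minBelow X b)
    (hcb : minBelow X c = minBelow X b) (hdb : minBelow X d = minBelow X b)
    (hac : a ≤ c) (had : a ≤ d) (hbc : b ≤ c) (hbd : b ≤ d)
    (hj : ∀ U ⊂ minBelow X b, U.Nonempty → ∃ z ∈ Y, minBelow X z = U ∧
      ∀ y ∈ Y, U ⊆ minBelow X y → z ≤ y)
    (hk : ∀ U ⊂ minBelow X b, minBelow X a ⊆ U → ∃ z ∈ Y, minBelow X z = U ∧ a ≤ z ∧
      ∀ y ∈ Y, a ≤ y → U ⊆ minBelow X y → z ≤ y)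
    (ι : Type) [Finite ι] [Nonempty ι] [LinearOrder ι] :
    ∃ (v : Unifier X) (α β : ι → v.Y) (γ : ι → ι → v.Y),
      (∀ i, v.u (α i) = a) ∧ (∀ k, v.u (β k) = b) ∧ (∀ i k, α i ≤ γ i k) ∧ (∀ i k, β k ≤ γ i k) ∧
      (∀ i k, i ≤ k → v.u (γ i k) = c) ∧ ∀ i k, k < i → v.u (γ i k) = d := by
  classical
  have : Nonempty X := ⟨a⟩
  choose! j hjY hjm hjl using hj
  choose! k hkY hkm hka hkl using hk
  set A := minBelow X a
  set B := minBelow X b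
  obtain ⟨x₀, hx₀⟩ : A.Nonempty := minBelow_nonempty a
  let K := (ι × A) ⊕ (ι × B)
  let S : ι → Set K := fun i => Set.range fun x : A => Sum.inl (i, x)
  let P := MarkedSets S
  let l : K → X := Sum.elim (fun q => q.2.1) (fun q => q.2.1)
  let L : P → Set X := fun p => l '' p.1.1
  have hLB : ∀ p, L p ⊆ B := by
    rintro p _ ⟨⟨i, x⟩ | ⟨i, x⟩, -, rfl⟩
    · exact hab.1 x.2
    · exact x.2
  have hLne : ∀ p, (L p).Nonempty := fun p => p.2.1.image l
  have hLmono : ∀ p q : P, p ≤ q → L p ⊆ L q := fun p q h => Set.image_mono h.1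
  have hAL : ∀ p : P, p.1.2.Nonempty → A ⊆ L p := by
    rintro p ⟨i, hi⟩ x hx
    exact ⟨Sum.inl (i, ⟨x, hx⟩), p.2.2 i hi ⟨_, rfl⟩, rfl⟩
  have hss : ∀ p, L p ≠ B → L p ⊂ B := fun p h => (hLB p).ssubset_of_ne h
  let R : P → Prop := fun p => ∃ i k, i ≤ k ∧ (∃ x, Sum.inl (i, x) ∈ p.1.1) ∧
    ∃ y, Sum.inr (k, y) ∈ p.1.1
  let f₀ : P → X := fun p =>
    if p.1.2.Nonempty then (if L p = B then (if R p then c else d) else k (L p))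
    else if L p = B then b else j (L p)
  have hspec : ∀ p, f₀ p ∈ Y ∧ minBelow X (f₀ p) = L p := by
    intro p
    simp only [f₀]
    split_ifs with h1 h2 h3 h2
    · exact ⟨hc, by rw [hcb, h2]⟩
    · exact ⟨hd, by rw [hdb, h2]⟩
    · exact ⟨hkY _ (hss p h2) (hAL p h1), hkm _ (hss p h2) (hAL p h1)⟩
    · exact ⟨hb, h2.symm⟩
    · exact ⟨hjY _ (hss p h2) (hLne p), hjm _ (hss p h2) (hLne p)⟩
  have hle : ∀ p, p.1.2.Nonempty → a ≤ f₀ p := by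
    intro p h1
    simp only [f₀, if_pos h1]
    split_ifs with h2 h3
    · exact hac
    · exact had
    · exact hka _ (hss p h2) (hAL p h1)
  have hbB : ¬ B ⊆ A := hab.2
  let D : Set P := {p | ∃ i₀ k₀, (∀ i x, Sum.inl (i, x) ∈ p.1.1 → i = i₀) ∧
    ∀ k y, Sum.inr (k, y) ∈ p.1.1 → k = k₀}
  have hsingle : ∀ q : K, f₀ (MarkedSets.single S q) = l q := by
    intro q
    have hL : L (MarkedSets.single S q) = {l q} := by simp [L, MarkedSets.single]
    have hlB : l q ∈ B := hLB (MarkedSets.single S q) (by rw [hL]; rfl)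
    have hne : L (MarkedSets.single S q) ≠ B := by
      rw [hL]
      intro h
      refine hbB fun x hx => ?_
      have h1 := hab.1 hx₀
      rw [← h] at hx h1
      rw [hx, ← h1]
      exact hx₀
    have hval : f₀ (MarkedSets.single S q) = j {l q} := by
      have : ¬ (MarkedSets.single S q).1.2.Nonempty := by simp [MarkedSets.single]
      simp only [f₀, if_neg this, if_neg hne]
      rw [hL]
    rw [hval]
    have hss' : {l q} ⊂ B := hL ▸ hss _ hne
    refine hlB.2 _ (hjl _ hss' (Set.singleton_nonempty _) _ (hY.1 b hb hlB) ?_)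
    rw [minBelow_of_mem hlB]
  obtain ⟨f, hf, hfD, -⟩ := hY.exists_isPMorphism_extension D
    (by
      rintro p q hqp ⟨i₀, k₀, hi, hk⟩
      exact ⟨i₀, k₀, fun i x hx => hi i x (hqp.1 hx), fun k y hy => hk k y (hqp.1 hy)⟩)
    (by
      intro m hm
      obtain ⟨q, -, rfl⟩ := MarkedSets.exists_eq_single hm
      rcases q with ⟨i, x⟩ | ⟨i, y⟩
      · exact ⟨i, i, fun _ _ h => (Prod.mk.inj (Sum.inl.inj h)).1,
          fun _ _ h => absurd h Sum.inr_ne_inl⟩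
      · exact ⟨i, i, fun _ _ h => absurd h Sum.inl_ne_inr,
          fun _ _ h => (Prod.mk.inj (Sum.inr.inj h)).1⟩)
    f₀ (fun p _ => (hspec p).1)
    (by
      rintro p - q ⟨i₀, k₀, hqi, hqk⟩ hpq
      by_cases h1 : p.1.2.Nonempty
      · have h1' : q.1.2.Nonempty := h1.mono hpq.2
        by_cases h2 : L p = B
        · have h2' : L q = B := (hLB q).antisymm (h2 ▸ hLmono p q hpq)
          have hR : R p ↔ R q := by
            constructor
            · rintro ⟨i, k, hik, ⟨x, hx⟩, y, hy⟩
              exact ⟨i, k, hik, ⟨x, hpq.1 hx⟩, y, hpq.1 hy⟩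
            · rintro ⟨i, k, hik, ⟨x, hx⟩, y, hy⟩
              obtain rfl := hqi i x hx
              obtain rfl := hqk k y hy
              refine ⟨i, k, hik, ?_, ?_⟩
              · obtain ⟨i', hi'⟩ := h1
                have hmem : (Sum.inl (i', ⟨x₀, hx₀⟩) : K) ∈ p.1.1 := p.2.2 i' hi' ⟨_, rfl⟩
                exact ⟨_, hqi i' _ (hpq.1 hmem) ▸ hmem⟩
              · by_contra! hno
                refine hbB fun z hz => ?_
                rw [← h2] at hz
                obtain ⟨⟨i', x'⟩ | ⟨k', y'⟩, hmem, rfl⟩ := hz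
                · exact x'.2
                · exact absurd (hqk k' _ (hpq.1 hmem) ▸ hmem) (hno y')
          simp only [f₀, if_pos h1, if_pos h1', if_pos h2, if_pos h2', hR, le_refl]
        · have : f₀ p = k (L p) := by simp only [f₀, if_pos h1, if_neg h2]
          rw [this]
          exact hkl _ (hss p h2) (hAL p h1) _ (hspec q).1 (hle q h1')
            ((hspec q).2 ▸ hLmono p q hpq)
      · by_cases h2 : L p = B
        · have h2' : L q = B := (hLB q).antisymm (h2 ▸ hLmono p q hpq)
          simp only [f₀, if_neg h1, if_pos h2, if_pos h2']
          split_ifs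
          · exact hbc
          · exact hbd
          · exact le_rfl
        · have : f₀ p = j (L p) := by simp only [f₀, if_neg h1, if_neg h2]
          rw [this]
          exact hjl _ (hss p h2) (hLne p) _ (hspec q).1 ((hspec q).2 ▸ hLmono p q hpq))
    (by
      intro p _
      rw [MarkedSets.minBelow_eq, Set.image_image, (hspec p).2]
      simp only [hsingle, L])
  let T : ι → Set K := fun k => Set.range fun y : B => Sum.inr (k, y)
  let α : ι → P := fun i => ⟨(S i, {i}), ⟨_, ⟨⟨x₀, hx₀⟩, rfl⟩⟩, by rintro _ rfl; exact subset_rfl⟩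
  let β : ι → P := fun k => ⟨(T k, ∅), ⟨_, ⟨⟨x₀, hab.1 hx₀⟩, rfl⟩⟩, by simp⟩
  let γ : ι → ι → P := fun i k => ⟨(S i ∪ T k, {i}), ⟨_, Or.inl ⟨⟨x₀, hx₀⟩, rfl⟩⟩,
    by rintro _ rfl; exact Set.subset_union_left⟩
  have hLα : ∀ i, L (α i) = A := fun i => by
    simp only [L, α, S, ← Set.range_comp]
    exact Subtype.range_coe
  have hLβ : ∀ i, L (β i) = B := fun i => by
    simp only [L, β, T, ← Set.range_comp]
    exact Subtype.range_coe
  have hαγ : ∀ i k, α i ≤ γ i k := fun i k => ⟨Set.subset_union_left, le_rfl⟩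
  have hβγ : ∀ i k, β k ≤ γ i k := fun i k => ⟨Set.subset_union_right, Set.empty_subset _⟩
  have hLγ : ∀ i k, L (γ i k) = B := fun i k =>
    (hLB _).antisymm (hLβ k ▸ hLmono _ _ (hβγ i k))
  have hγD : ∀ i k, γ i k ∈ D := by
    refine fun i k => ⟨i, k, ?_, ?_⟩
    · rintro _ _ (⟨_, h⟩ | ⟨_, h⟩) <;> cases h
      rfl
    · rintro _ _ (⟨_, h⟩ | ⟨_, h⟩) <;> cases h
      rfl
  have hγR : ∀ i k, R (γ i k) ↔ i ≤ k := by
    intro i k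
    constructor
    · rintro ⟨i', k', h, ⟨x, ⟨_, hx⟩ | ⟨_, hx⟩⟩, y, ⟨_, hy⟩ | ⟨_, hy⟩⟩ <;> cases hx <;> cases hy
      exact h
    · exact fun h => ⟨i, k, h, ⟨⟨x₀, hx₀⟩, Or.inl ⟨_, rfl⟩⟩, ⟨x₀, hab.1 hx₀⟩, Or.inr ⟨_, rfl⟩⟩
  refine ⟨⟨P, ⟨α (Classical.arbitrary ι)⟩, MarkedSets.starCond S, f, hf⟩, α, β, γ, ?_, ?_, hαγ, hβγ,
    ?_, ?_⟩
  · intro i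
    have hD : α i ∈ D := ⟨i, i, by rintro _ _ ⟨_, ⟨⟩⟩; rfl, by rintro _ _ ⟨_, ⟨⟩⟩⟩
    have hn : (α i).1.2.Nonempty := Set.singleton_nonempty i
    have hval : f₀ (α i) = k A := by
      simp only [f₀, if_pos hn, hLα, if_neg hab.ne]
    exact (hfD hD).trans ((hval.trans_le (hkl A hab subset_rfl a ha le_rfl subset_rfl)).antisymm
      (hle _ hn))
  · intro i
    have hD : β i ∈ D := ⟨i, i, by rintro _ _ ⟨_, ⟨⟩⟩, by rintro _ _ ⟨_, ⟨⟩⟩; rfl⟩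
    refine (hfD hD).trans ?_
    simp only [f₀, if_neg (show ¬ (β i).1.2.Nonempty by simp [β]), hLβ, if_true]
  · intro i k h
    refine (hfD (hγD i k)).trans ?_
    simp only [f₀, if_pos (show (γ i k).1.2.Nonempty from Set.singleton_nonempty i), hLγ, if_true,
      if_pos ((hγR i k).2 h)]
  · intro i k h
    refine (hfD (hγD i k)).trans ?_
    simp only [f₀, if_pos (show (γ i k).1.2.Nonempty from Set.singleton_nonempty i), hLγ, if_true,
      if_neg (fun h' => h.not_ge ((hγR i k).1 h'))]

theorem card_le_of_halfGraph (h : ¬ ∃ e, a ≤ e ∧ b ≤ e ∧ e ≤ c ∧ e ≤ d) {ι : Type} [LinearOrder ι]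
    {v w : Unifier X} (hvw : UnifierLE v w) (α β : ι → v.Y) (γ : ι → ι → v.Y)
    (hα : ∀ i, v.u (α i) = a) (hβ : ∀ k, v.u (β k) = b) (hαγ : ∀ i k, α i ≤ γ i k)
    (hβγ : ∀ i k, β k ≤ γ i k) (hc : ∀ i k, i ≤ k → v.u (γ i k) = c)
    (hd : ∀ i k, k < i → v.u (γ i k) = d) :
    Nat.card ι ≤ Nat.card w.Y := by
  obtain ⟨ψ, hψ, hψu⟩ := hvw
  have hu : ∀ x, w.u (ψ x) = v.u x := congrFun hψu
  have key : ∀ i i', i < i' → ψ (α i) ≠ ψ (α i') := by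
    intro i i' hlt heq
    obtain ⟨z, hz, -⟩ := w.star (ψ (α i)) (ψ (β i))
    have h1 : z ≤ ψ (γ i i) := hz.2 (by
      rintro _ (rfl | rfl)
      exacts [hψ.1 (hαγ i i), hψ.1 (hβγ i i)])
    have h2 : z ≤ ψ (γ i' i) := hz.2 (by
      rintro _ (rfl | rfl)
      exacts [heq ▸ hψ.1 (hαγ i' i), hψ.1 (hβγ i' i)])
    refine h ⟨w.u z, ?_, ?_, ?_, ?_⟩
    · rw [← hα i, ← hu]
      exact w.hu.1 (hz.1 (by simp))
    · rw [← hβ i, ← hu]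
      exact w.hu.1 (hz.1 (by simp))
    · rw [← hc i i le_rfl, ← hu]
      exact w.hu.1 h1
    · rw [← hd i' i hlt, ← hu]
      exact w.hu.1 h2
  refine Nat.card_le_card_of_injective (fun i => ψ (α i)) fun i i' heq => ?_
  rcases lt_trichotomy i i' with hlt | rfl | hlt
  · exact absurd heq (key _ _ hlt)
  · rfl
  · exact absurd heq.symm (key _ _ hlt)

end HalfGraph

section BoundedJoins

variable {X : Type*} [PartialOrder X] {Y : Set X} {n : ℕ}

theorem coe_image_minBelow [Finite X] (hY : ∀ y ∈ Y, minBelow X y ⊆ Y) (y : Y) :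
    Subtype.val '' minBelow Y y = minBelow X y := by
  ext m
  constructor
  · rintro ⟨m, ⟨hmy, hm⟩, rfl⟩
    obtain ⟨z, hz⟩ := minBelow_nonempty (m : X)
    have : (⟨z, hY m m.2 hz⟩ : Y) = m := hm _ hz.1
    rw [← this]
    exact ⟨hz.1.trans hmy, hz.2⟩
  · intro hm
    exact ⟨⟨m, hY y y.2 hm⟩, ⟨hm.1, fun z hz => Subtype.ext (hm.2 z hz)⟩, rfl⟩

theorem StarCondN.exists_isLeast [Finite X] (h : StarCondN n {y : X // y ∈ Y})
    (hY : ∀ y ∈ Y, minBelow X y ⊆ Y) {x y : X} (hx : x ∈ Y) (hy : y ∈ Y)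
    (hn : (minBelow X x ∪ minBelow X y).ncard ≤ n) :
    ∃ z ∈ Y, minBelow X z = minBelow X x ∪ minBelow X y ∧ x ≤ z ∧ y ≤ z ∧
      ∀ t ∈ Y, x ≤ t → y ≤ t → z ≤ t := by
  have himg := coe_image_minBelow hY
  obtain ⟨z, hz, hmin⟩ := h ⟨x, hx⟩ ⟨y, hy⟩ (by
    rwa [← Set.ncard_image_of_injective _ Subtype.val_injective, Set.image_union, himg ⟨x, hx⟩,
      himg ⟨y, hy⟩])
  refine ⟨z, z.2, ?_, hz.1 (Set.mem_insert _ _), hz.1 (Set.mem_insert_of_mem _ rfl), ?_⟩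
  · rw [← himg z, hmin, Set.image_union, himg ⟨x, hx⟩, himg ⟨y, hy⟩]
  · intro t ht hxt hyt
    have hub : (⟨t, ht⟩ : {y : X // y ∈ Y}) ∈ upperBounds {⟨x, hx⟩, ⟨y, hy⟩} := by
      rintro _ (rfl | rfl) <;> assumption
    exact hz.2 hub

theorem StarCondN.exists_isLeast_of_minBelow [Finite X] (h : StarCondN n {y : X // y ∈ Y})
    (hY : ∀ y ∈ Y, minBelow X y ⊆ Y) {U : Set X} {x : X} (hx : x ∈ Y) (hUx : U ⊆ minBelow X x)
    (hU : U.Nonempty) (hn : U.ncard ≤ n) :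
    ∃ z ∈ Y, minBelow X z = U ∧ ∀ y ∈ Y, U ⊆ minBelow X y → z ≤ y := by
  induction U, U.toFinite using Set.Finite.induction_on with
  | empty => exact absurd hU (by simp)
  | @insert m U _ _ ih =>
    have hm : m ∈ minBelow X x := hUx (Set.mem_insert _ _)
    have hmY : m ∈ Y := hY x hx hm
    rcases U.eq_empty_or_nonempty with rfl | hU'
    · exact ⟨m, hmY, by simpa using minBelow_of_mem hm,
        fun y _ hy => (hy (Set.mem_insert _ _)).1⟩
    · obtain ⟨z, hz, hzm, hzl⟩ := ih ((Set.subset_insert _ _).trans hUx) hU'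
        ((Set.ncard_le_ncard (Set.subset_insert _ _)).trans hn)
      have hunion : minBelow X m ∪ minBelow X z = insert m U := by
        rw [minBelow_of_mem hm, hzm, Set.singleton_union]
      obtain ⟨t, ht, htm, -, -, htl⟩ := h.exists_isLeast hY hmY hz (hunion ▸ hn)
      refine ⟨t, ht, htm.trans hunion, fun y hy hUy => htl y hy (hUy (Set.mem_insert _ _)).1
        (hzl y hy ((Set.subset_insert _ _).trans hUy))⟩

theorem IsConnectedSub.insert_of_minBelow_eq (hY : IsConnectedSub X Y) {c e : X} (hc : c ∈ Y)
    (hec : e ≤ c) (hmin : minBelow X e = minBelow X c) : IsConnectedSub X (insert e Y) := by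
  have hub : ∀ y ∈ Y, ∃ z ∈ insert e Y, e ≤ z ∧ y ≤ z ∧
      minBelow X z = minBelow X e ∪ minBelow X y := fun y hy => by
    obtain ⟨z, hz, hcz, hyz, hzm⟩ := hY.2 c hc y hy
    exact ⟨z, Set.mem_insert_of_mem _ hz, hec.trans hcz, hyz, by rw [hzm, hmin]⟩
  constructor
  · rintro y (rfl | hy)
    · rw [hmin]
      exact (hY.1 c hc).trans (Set.subset_insert _ _)
    · exact (hY.1 y hy).trans (Set.subset_insert _ _)
  · rintro x (rfl | hx) y (rfl | hy)
    · exact ⟨_, Set.mem_insert _ _, le_rfl, le_rfl, (Set.union_self _).symm⟩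
    · exact hub y hy
    · obtain ⟨z, hz, h1, h2, h3⟩ := hub x hx
      exact ⟨z, hz, h2, h1, by rw [h3, Set.union_comm]⟩
    · obtain ⟨z, hz, h⟩ := hY.2 x hx y hy
      exact ⟨z, Set.mem_insert_of_mem _ hz, h⟩

end BoundedJoins

/-- Lemma (strictly contained min-sets case): the given configuration in a maximal
connected subset forces unification type 0. -/
theorem maximal_connected_ssubset_config_type_zero (X : Type) [PartialOrder X] [Finite X] (Y : Set X)
    (hYcon : IsConnectedSub X Y)
    (hYmax : ∀ Z : Set X, IsConnectedSub X Z → Y ⊆ Z → Y = Z)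
    (a b c d : X) (ha : a ∈ Y) (hb : b ∈ Y) (hc : c ∈ Y) (hd : d ∈ Y)
    (n : ℕ) (hn : 1 ≤ n)
    (h1 : StarCondN' (n - 1) {y : X // y ∈ Y})
    (h2 : (minBelow X a ∪ minBelow X b).ncard = n)
    (h3 : minBelow X a ⊂ minBelow X b)
    (h4c : minBelow X c = minBelow X a ∪ minBelow X b)
    (h4d : minBelow X d = minBelow X a ∪ minBelow X b)
    (h5 : a ≤ c ∧ a ≤ d ∧ b ≤ c ∧ b ≤ d)
    (h6 : ¬ ∃ e ∈ Y, a ≤ e ∧ b ≤ e ∧ e ≤ c ∧ e ≤ d) :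
    ¬ ∃ M : Set (Unifier X), IsMinimalCompleteSet UnifierLE M := by
  have hU : minBelow X a ∪ minBelow X b = minBelow X b := Set.union_eq_self_of_subset_left h3.1
  rw [hU] at h2 h4c h4d
  obtain ⟨hac, had, hbc, hbd⟩ := h5
  have hlt : ∀ U ⊂ minBelow X b, U.ncard ≤ n - 1 := fun U hU => by
    have := Set.ncard_lt_ncard hU
    omega
  have hstar : StarCondN (n - 1) {y : X // y ∈ Y} := by
    have h0 : 0 < (minBelow X a).ncard :=
      (Set.ncard_pos (Set.toFinite _)).2 (minBelow_nonempty a)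
    have := hlt _ h3
    rwa [StarCondN', if_neg (by omega)] at h1
  have hnone : ¬ ∃ e, a ≤ e ∧ b ≤ e ∧ e ≤ c ∧ e ≤ d := by
    rintro ⟨e, hae, hbe, hec, hed⟩
    have hmin : minBelow X e = minBelow X c :=
      (minBelow_mono hec).antisymm (h4c ▸ minBelow_mono hbe)
    have hins := hYmax _ (hYcon.insert_of_minBelow_eq hc hec hmin) (Set.subset_insert _ _)
    exact h6 ⟨e, hins ▸ Set.mem_insert _ _, hae, hbe, hec, hed⟩
  refine not_exists_isMinimalCompleteSet_of_forall_card fun N => ?_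
  obtain ⟨v, α, β, γ, hα, hβ, hαγ, hβγ, hγc, hγd⟩ :=
    hYcon.exists_unifier_halfGraph ha hb hc hd h3 h4c h4d hac had hbc hbd
      (fun U hU hne => hstar.exists_isLeast_of_minBelow hYcon.1 hb hU.1 hne (hlt U hU))
      (by
        intro U hU haU
        obtain ⟨z, hz, hzm, hzl⟩ := hstar.exists_isLeast_of_minBelow hYcon.1 hb hU.1
          ((minBelow_nonempty a).mono haU) (hlt U hU)
        have hunion : minBelow X a ∪ minBelow X z = U := by
          rw [hzm, Set.union_eq_self_of_subset_left haU]
        obtain ⟨t, ht, htm, hat, -, htl⟩ :=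
          hstar.exists_isLeast hYcon.1 ha hz (hunion ▸ hlt U hU)
        exact ⟨t, ht, htm.trans hunion, hat, fun y hy hay hUy => htl y hy hay (hzl y hy hUy)⟩)
      (Fin (N + 1))
  refine ⟨v, fun w hw => ?_⟩
  have := card_le_of_halfGraph hnone hw α β γ hα hβ hαγ hβγ hγc hγd
  rw [Nat.card_fin] at this
  omega
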